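/- Let q = 2^h be a power of 2 and F a finite field with q elements. Let L be a 2-dimensional F-linear subspace of Sym₃(F) spanned by two rank-2 matrices R and S whose column spaces are distinct (2-dimensional) subspaces of F³, and suppose L contains no nonzero matrix with all diagonal entries 0. Then: (i) L contains no rank-1 matrix; (ii) the number of 1-dimensional subspaces of L spanned by rank-2 matrices is either 2 or 3; and (iii) if this number is 3, then the column spaces of the three rank-2 points are three pairwise-distinct 2-dimensional subspaces of F³ whose common intersection is {0} (i.e., the corresponding three lines of PG(2,q) are non-concurrent). -/

import Mathlib

open Matrix

/-- A *point* of a subspace `L` of the space of symmetric `3×3` matrices: a 1-dimensional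
linear subspace `P ≤ L`, all of whose nonzero matrices satisfy the predicate `pred`. -/
def IsPointOf (F : Type) [Field F] (L P : Submodule F (Matrix (Fin 3) (Fin 3) F))
    (pred : Matrix (Fin 3) (Fin 3) F → Prop) : Prop :=
  P ≤ L ∧ Module.finrank F ↥P = 1 ∧ ∀ M ∈ P, M ≠ 0 → pred M

/-- The column space of a matrix. -/
def colSpace (F : Type) [Field F] (M : Matrix (Fin 3) (Fin 3) F) : Submodule F (Fin 3 → F) :=
  LinearMap.range M.mulVecLin

section

variable {F : Type} [Field F]

theorem rank_add_finrank_ker_mulVecLin (M : Matrix (Fin 3) (Fin 3) F) :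
    M.rank + Module.finrank F (LinearMap.ker M.mulVecLin) = 3 := by
  simpa [Matrix.rank] using LinearMap.finrank_range_add_finrank_ker M.mulVecLin

theorem exists_mulVec_eq_zero_of_rank_eq_two {M : Matrix (Fin 3) (Fin 3) F} (hM : M.rank = 2) :
    ∃ u, u ≠ 0 ∧ M *ᵥ u = 0 ∧ ∀ w, M *ᵥ w = 0 → ∃ k : F, k • u = w := by
  have h1 : Module.finrank F (LinearMap.ker M.mulVecLin) = 1 := by
    have := rank_add_finrank_ker_mulVecLin M
    omega
  obtain ⟨⟨u, hu⟩, hu0, hspan⟩ := finrank_eq_one_iff'.1 h1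
  refine ⟨u, by simpa using hu0, by simpa using hu, fun w hw => ?_⟩
  obtain ⟨k, hk⟩ := hspan ⟨w, by simpa using hw⟩
  exact ⟨k, congrArg Subtype.val hk⟩

theorem rank_le_two_of_det_eq_zero {M : Matrix (Fin 3) (Fin 3) F} (hM : M.det = 0) :
    M.rank ≤ 2 := by
  obtain ⟨v, hv0, hv⟩ := Matrix.exists_mulVec_eq_zero_iff.2 hM
  have hker : LinearMap.ker M.mulVecLin ≠ ⊥ := fun hbot =>
    hv0 ((Submodule.mem_bot F).1 (hbot ▸ (by simpa using hv : v ∈ LinearMap.ker M.mulVecLin)))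
  have := rank_add_finrank_ker_mulVecLin M
  have := Submodule.one_le_finrank_iff.2 hker
  omega

theorem two_le_rank_of_minor_ne_zero {M : Matrix (Fin 3) (Fin 3) F} (i j : Fin 3)
    (hM : M i i * M j j - M i j * M j i ≠ 0) : 2 ≤ M.rank := by
  have h1 := Matrix.rank_submatrix_le M ![i, j] ![i, j]
  rwa [Matrix.rank_of_det_ne_zero (by rwa [Matrix.det_fin_two]),
    Fintype.card_fin] at h1

theorem dotProduct_eq_zero_of_mem_colSpace {M : Matrix (Fin 3) (Fin 3) F} (hM : M.IsSymm)
    {u z : Fin 3 → F} (hu : M *ᵥ u = 0) (hz : z ∈ colSpace F M) : u ⬝ᵥ z = 0 := by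
  obtain ⟨t, rfl⟩ := hz
  rw [Matrix.mulVecLin_apply, Matrix.dotProduct_mulVec, ← Matrix.mulVec_transpose, hM.eq, hu,
    zero_dotProduct]

theorem finrank_colSpace (M : Matrix (Fin 3) (Fin 3) F) :
    Module.finrank F (colSpace F M) = M.rank := rfl

theorem colSpace_eq_of_common_kernel {R S : Matrix (Fin 3) (Fin 3) F}
    (hR : R.IsSymm) (hS : S.IsSymm) (hRrk : R.rank = 2) (hSrk : S.rank = 2)
    {u : Fin 3 → F} (hu : u ≠ 0) (hRu : R *ᵥ u = 0) (hSu : S *ᵥ u = 0) :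
    colSpace F R = colSpace F S := by
  have hle : ∀ z ∈ colSpace F R ⊔ colSpace F S, u ⬝ᵥ z = 0 := by
    intro z hz
    obtain ⟨x, hx, y, hy, rfl⟩ := Submodule.mem_sup.1 hz
    rw [dotProduct_add, dotProduct_eq_zero_of_mem_colSpace hR hRu hx,
      dotProduct_eq_zero_of_mem_colSpace hS hSu hy, add_zero]
  have hlt : Module.finrank F ↥(colSpace F R ⊔ colSpace F S) < 3 := by
    have := Submodule.finrank_lt (s := colSpace F R ⊔ colSpace F S) (fun htop =>
      hu (dotProduct_eq_zero u fun w => hle w (htop ▸ Submodule.mem_top)))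
    simpa using this
  have h1 : colSpace F R = colSpace F R ⊔ colSpace F S :=
    Submodule.eq_of_le_of_finrank_le le_sup_left (by rw [finrank_colSpace]; omega)
  have h2 : colSpace F S = colSpace F R ⊔ colSpace F S :=
    Submodule.eq_of_le_of_finrank_le le_sup_right (by rw [finrank_colSpace]; omega)
  exact h1.trans h2.symm

theorem conj_apply (Q M : Matrix (Fin 3) (Fin 3) F) (i j : Fin 3) :
    (Q * M * Qᵀ) i j = Q i ⬝ᵥ M *ᵥ Q j := by
  rw [Matrix.mul_assoc, Matrix.mul_apply']
  rfl

theorem conj_isSymm {M : Matrix (Fin 3) (Fin 3) F} (hM : M.IsSymm)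
    (Q : Matrix (Fin 3) (Fin 3) F) : (Q * M * Qᵀ).IsSymm := by
  simp [Matrix.IsSymm, Matrix.transpose_mul, hM.eq, Matrix.mul_assoc]

theorem exists_congruence_normal_form {R S : Matrix (Fin 3) (Fin 3) F}
    (hR : R.IsSymm) (hS : S.IsSymm) (hRrk : R.rank = 2) (hSrk : S.rank = 2)
    (hcol : colSpace F R ≠ colSpace F S) :
    ∃ (Q : Matrix (Fin 3) (Fin 3) F) (a b c d e f : F), Q.det ≠ 0 ∧
      Q * R * Qᵀ = !![c, 0, b; 0, 0, 0; b, 0, a] ∧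
      Q * S * Qᵀ = !![f, e, 0; e, d, 0; 0, 0, 0] := by
  obtain ⟨u, hu0, hRu, -⟩ := exists_mulVec_eq_zero_of_rank_eq_two hRrk
  obtain ⟨v, hv0, hSv, -⟩ := exists_mulVec_eq_zero_of_rank_eq_two hSrk
  have hSu : S *ᵥ u ≠ 0 := fun hSu =>
    hcol (colSpace_eq_of_common_kernel hR hS hRrk hSrk hu0 hRu hSu)
  have hind : LinearIndependent F ![u, v] := by
    rw [LinearIndependent.pair_iff]
    intro s t hst
    have hs : s = 0 := by
      have := congrArg (S *ᵥ ·) hst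
      simpa [Matrix.mulVec_add, Matrix.mulVec_smul, hSv, hSu] using this
    subst hs
    simpa [hv0] using hst
  have hcross := crossProduct_ne_zero_iff_linearIndependent.2 hind
  obtain ⟨w, hw⟩ : ∃ w, crossProduct u v ⬝ᵥ w ≠ 0 := by
    by_contra! hall
    exact hcross (dotProduct_eq_zero _ hall)
  rw [dotProduct_comm, triple_product_eq_det] at hw
  let Q : Matrix (Fin 3) (Fin 3) F := ![w, u, v]
  have hA := conj_isSymm hR Q
  have hB := conj_isSymm hS Q
  have hA1 : ∀ j, (Q * R * Qᵀ) j 1 = 0 := fun j => by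
    rw [conj_apply, show Q 1 = u from rfl, hRu, dotProduct_zero]
  have hB2 : ∀ j, (Q * S * Qᵀ) j 2 = 0 := fun j => by
    rw [conj_apply, show Q 2 = v from rfl, hSv, dotProduct_zero]
  refine ⟨Q, (Q * R * Qᵀ) 2 2, (Q * R * Qᵀ) 0 2, (Q * R * Qᵀ) 0 0, (Q * S * Qᵀ) 1 1,
    (Q * S * Qᵀ) 0 1, (Q * S * Qᵀ) 0 0, hw, ?_, ?_⟩
  · generalize Q * R * Qᵀ = A at *
    ext i j
    fin_cases i <;> fin_cases j <;> simp [hA1, hA.apply 0 2] <;>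
      first | rfl | (rw [hA.apply]; simp [hA1])
  · generalize Q * S * Qᵀ = B at *
    ext i j
    fin_cases i <;> fin_cases j <;> simp [hB2, hB.apply 0 1] <;>
      first | rfl | (rw [hB.apply]; simp [hB2])

theorem minor_ne_zero_of_rank_eq_two {a b c : F}
    (h : (!![c, 0, b; 0, 0, 0; b, 0, a] : Matrix (Fin 3) (Fin 3) F).rank = 2) :
    a * c - b * b ≠ 0 := by
  intro hm
  obtain ⟨u, -, -, hker⟩ := exists_mulVec_eq_zero_of_rank_eq_two h
  obtain ⟨k, hk⟩ := hker ![0, 1, 0] (by ext i; fin_cases i <;> simp)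
  have hk1 : k * u 1 = 1 := by simpa using congrFun hk 1
  have hk0 : k ≠ 0 := left_ne_zero_of_mul (hk1 ▸ one_ne_zero)
  have hu0 : u 0 = 0 := by simpa [hk0] using congrFun hk 0
  have hu2 : u 2 = 0 := by simpa [hk0] using congrFun hk 2
  obtain ⟨l, hl⟩ := hker ![a, 0, -b] (by
    ext i
    fin_cases i <;> simp [Matrix.mulVec, dotProduct, Fin.sum_univ_three]
    · linear_combination hm
    · ring)
  have ha : a = 0 := by simpa [hu0] using (congrFun hl 0).symm
  have hb : b = 0 := by simpa [hu2] using (congrFun hl 2).symm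
  subst ha hb
  obtain ⟨n, hn⟩ := hker ![0, 0, 1] (by ext i; fin_cases i <;> simp)
  simpa [hu2] using congrFun hn 2

theorem rank_permuted_normal_form (d e f : F) :
    (!![f, e, 0; e, d, 0; 0, 0, 0] : Matrix (Fin 3) (Fin 3) F).rank =
      (!![f, 0, e; 0, 0, 0; e, 0, d] : Matrix (Fin 3) (Fin 3) F).rank := by
  rw [← Matrix.rank_submatrix !![f, 0, e; 0, 0, 0; e, 0, d] (Equiv.swap 1 2) (Equiv.swap 1 2)]
  congr 1
  ext i j
  fin_cases i <;> fin_cases j <;> rfl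

theorem congruence_diag_eq_zero [CharP F 2] (G : Matrix (Fin 3) (Fin 3) F) (x y z : F)
    (i : Fin 3) : (G * !![0, x, y; x, 0, z; y, z, 0] * Gᵀ) i i = 0 := by
  have h2 : (2 : F) = 0 := CharTwo.two_eq_zero
  simp only [Matrix.mul_apply, Fin.sum_univ_three, Matrix.transpose_apply]
  simp
  linear_combination (G i 0 * G i 1 * x + G i 0 * G i 2 * y + G i 1 * G i 2 * z) * h2

theorem diag_eq_zero_of_congruent [CharP F 2] {Q M : Matrix (Fin 3) (Fin 3) F} (hQ : Q.det ≠ 0)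
    {x y z : F} (hM : Q * M * Qᵀ = !![0, x, y; x, 0, z; y, z, 0]) (i : Fin 3) : M i i = 0 := by
  have hQ' : IsUnit Q.det := hQ.isUnit
  have h1 : Q⁻¹ * (Q * M * Qᵀ) * Q⁻¹ᵀ = M := by
    rw [Matrix.mul_assoc Q M, Matrix.nonsing_inv_mul_cancel_left _ _ hQ', Matrix.mul_assoc,
      ← Matrix.transpose_mul, Matrix.nonsing_inv_mul _ hQ', Matrix.transpose_one, Matrix.mul_one]
  rw [← h1, hM]
  exact congruence_diag_eq_zero _ _ _ _ _

theorem rank_conj {Q : Matrix (Fin 3) (Fin 3) F} (hQ : Q.det ≠ 0)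
    (M : Matrix (Fin 3) (Fin 3) F) : (Q * M * Qᵀ).rank = M.rank := by
  rw [Matrix.rank_mul_eq_left_of_isUnit_det _ _ (by simpa using hQ),
    Matrix.rank_mul_eq_right_of_isUnit_det _ _ hQ.isUnit]

theorem rank_eq_two_iff_det_eq_zero {M : Matrix (Fin 3) (Fin 3) F} (hM : 2 ≤ M.rank) :
    M.rank = 2 ↔ M.det = 0 := by
  refine ⟨fun h => ?_, fun h => le_antisymm (rank_le_two_of_det_eq_zero h) hM⟩
  by_contra hdet
  simp [Matrix.rank_of_det_ne_zero hdet] at h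

theorem mulVec_of_mem_colSpace {Q M : Matrix (Fin 3) (Fin 3) F} (hQ : Q.det ≠ 0)
    {z : Fin 3 → F} (hz : z ∈ colSpace F M) : ∃ t, (Q * M * Qᵀ) *ᵥ t = Q *ᵥ z := by
  obtain ⟨t, rfl⟩ := hz
  refine ⟨Qᵀ⁻¹ *ᵥ t, ?_⟩
  rw [Matrix.mulVec_mulVec, Matrix.mulVecLin_apply, Matrix.mulVec_mulVec,
    Matrix.mul_nonsing_inv_cancel_right _ _ (by simpa using hQ)]

/-- In a pencil `x R + y S` spanned by two symmetric rank-2 matrices with distinct column spaces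
and containing no alternating matrix, the rank-2 members are cut out by
`x * y * (q * x - p * y) = 0`. -/
theorem exists_pencil_determinant [CharP F 2] {R S : Matrix (Fin 3) (Fin 3) F}
    (hR : R.IsSymm) (hS : S.IsSymm) (hRrk : R.rank = 2) (hSrk : S.rank = 2)
    (hcol : colSpace F R ≠ colSpace F S)
    (hnuc : ∀ x y : F, x ≠ 0 ∨ y ≠ 0 → ∃ i, (x • R + y • S) i i ≠ 0) :
    ∃ p q : F, (p ≠ 0 ∨ q ≠ 0) ∧
      (∀ x y : F, x ≠ 0 ∨ y ≠ 0 → 2 ≤ (x • R + y • S).rank ∧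
        ((x • R + y • S).rank = 2 ↔ x * y * (q * x - p * y) = 0)) ∧
      (p ≠ 0 → q ≠ 0 →
        colSpace F R ⊓ colSpace F S ⊓ colSpace F (p • R + q • S) = ⊥) := by
  obtain ⟨Q, a, b, c, d, e, f, hQ, hA, hB⟩ :=
    exists_congruence_normal_form hR hS hRrk hSrk hcol
  have hk : a * c - b * b ≠ 0 := minor_ne_zero_of_rank_eq_two (by rw [← hA, rank_conj hQ, hRrk])
  have hl : d * f - e * e ≠ 0 := minor_ne_zero_of_rank_eq_two (by
    rw [← rank_permuted_normal_form, ← hB, rank_conj hQ, hSrk])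
  have hN : ∀ x y : F, Q * (x • R + y • S) * Qᵀ =
      !![x * c + y * f, y * e, x * b; y * e, y * d, 0; x * b, 0, x * a] := by
    intro x y
    rw [Matrix.mul_add, Matrix.add_mul, Matrix.mul_smul, Matrix.mul_smul, Matrix.smul_mul,
      Matrix.smul_mul, hA, hB]
    ext i j
    fin_cases i <;> fin_cases j <;> simp
  have had : a ≠ 0 ∨ d ≠ 0 := by
    by_contra! hcon
    obtain ⟨rfl, rfl⟩ := hcon
    obtain ⟨x, y, hxy, hfc⟩ : ∃ x y : F, (x ≠ 0 ∨ y ≠ 0) ∧ x * c + y * f = 0 := by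
      by_cases hf : f = 0
      · exact ⟨0, 1, by simp, by simp [hf]⟩
      · exact ⟨f, -c, Or.inl hf, by ring⟩
    obtain ⟨i, hi⟩ := hnuc x y hxy
    have := hN x y
    rw [hfc, mul_zero, mul_zero] at this
    exact hi (diag_eq_zero_of_congruent hQ this i)
  have hdet : ∀ x y : F, (Q * (x • R + y • S) * Qᵀ).det =
      x * y * (d * (a * c - b * b) * x + a * (d * f - e * e) * y) := by
    intro x y
    rw [hN, Matrix.det_fin_three]
    simp
    ring
  refine ⟨-(a * (d * f - e * e)), d * (a * c - b * b), ?_, fun x y hxy => ?_, fun hp hq => ?_⟩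
  · simpa [hk, hl] using had
  · have h2 : 2 ≤ (Q * (x • R + y • S) * Qᵀ).rank := by
      by_cases hx : x = 0
      · have hy : y ≠ 0 := by simpa [hx] using hxy
        refine two_le_rank_of_minor_ne_zero 0 1 ?_
        rw [hN]
        convert mul_ne_zero (mul_ne_zero hy hy) hl using 1
        simp [hx]
        ring
      by_cases hy : y = 0
      · refine two_le_rank_of_minor_ne_zero 0 2 ?_
        rw [hN]
        convert mul_ne_zero (mul_ne_zero hx hx) hk using 1
        simp [hy]
        ring
      by_cases had' : a * d = 0
      · have hdet0 : (Q * (x • R + y • S) * Qᵀ).det ≠ 0 := by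
          rw [hdet]
          rcases mul_eq_zero.1 had' with h0 | h0 <;> simp_all
        simp [Matrix.rank_of_det_ne_zero hdet0]
      · refine two_le_rank_of_minor_ne_zero 1 2 ?_
        rw [hN]
        convert mul_ne_zero (mul_ne_zero hx hy) had' using 1
        simp
        ring
    rw [← rank_conj hQ]
    refine ⟨h2, ?_⟩
    rw [rank_eq_two_iff_det_eq_zero h2, hdet, neg_mul, sub_neg_eq_add]
  · rw [eq_bot_iff]
    rintro z ⟨⟨hzR, hzS⟩, hzT⟩
    obtain ⟨r, hr⟩ := mulVec_of_mem_colSpace hQ hzR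
    obtain ⟨s, hs⟩ := mulVec_of_mem_colSpace hQ hzS
    obtain ⟨t, ht⟩ := mulVec_of_mem_colSpace hQ hzT
    rw [hA] at hr
    rw [hB] at hs
    rw [hN] at ht
    refine (Submodule.mem_bot F).2 (Matrix.eq_zero_of_mulVec_eq_zero hQ ?_)
    generalize Q *ᵥ z = w at hr hs ht ⊢
    set p := -(a * (d * f - e * e)) with hpdef
    set q := d * (a * c - b * b) with hqdef
    have h1 : w 1 = 0 := by rw [← hr]; simp
    have h2 : w 2 = 0 := by rw [← hs]; simp
    have t0 := congrFun ht 0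
    have t1 := (congrFun ht 1).trans h1
    have t2 := (congrFun ht 2).trans h2
    simp [Matrix.mulVec_eq_sum, Fin.sum_univ_three] at t0 t1 t2
    have ha : a ≠ 0 := fun h => hp (by simp [hpdef, h])
    have hd : d ≠ 0 := fun h => hq (by simp [hqdef, h])
    have h0 : w 0 = 0 := by
      have : (p * q * a * d) * w 0 = 0 := by
        linear_combination (-(p * q * a * d)) * t0 + p * q * a * e * t1 + p * q * b * d * t2 -
          t 0 * p * q * p * hqdef + t 0 * p * q * q * hpdef
      simpa [hp, hq, ha, hd] using this
    ext i
    fin_cases i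
    exacts [h0, h1, h2]

theorem colSpace_le_of_mem_span {M N : Matrix (Fin 3) (Fin 3) F}
    (h : M ∈ Submodule.span F {N}) : colSpace F M ≤ colSpace F N := by
  obtain ⟨k, rfl⟩ := Submodule.mem_span_singleton.1 h
  rintro _ ⟨t, rfl⟩
  exact ⟨k • t, by simp⟩

theorem ne_of_inf_inf_eq_bot {U V W : Submodule F (Fin 3 → F)} (hU : Module.finrank F U = 2)
    (hW : Module.finrank F W = 2) (h : U ⊓ V ⊓ W = ⊥) : U ≠ V := by
  rintro rfl
  rw [inf_idem] at h
  have h1 := Submodule.finrank_sup_add_finrank_inf_eq U W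
  have h2 : Module.finrank F ↥(U ⊔ W) ≤ 3 := by simpa using Submodule.finrank_le (U ⊔ W)
  rw [h, finrank_bot] at h1
  omega

theorem span_combination_ne {V : Type} [AddCommGroup V] [Module F V] {R S : V}
    (hind : LinearIndependent F ![R, S]) {x y x' y' : F} (h : x * y' ≠ x' * y) :
    Submodule.span F {x • R + y • S} ≠ Submodule.span F {x' • R + y' • S} := by
  intro heq
  rw [LinearIndependent.pair_iff] at hind
  obtain ⟨l, hl⟩ := Submodule.mem_span_singleton.1
    (heq ▸ Submodule.mem_span_singleton_self (x • R + y • S))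
  obtain ⟨h3, h4⟩ := hind (l * x' - x) (l * y' - y) (by
    rw [← sub_eq_zero] at hl
    rw [← hl]
    module)
  apply h
  linear_combination -y' * h3 + x' * h4

theorem span_singleton_eq_of_smul {V : Type} [AddCommGroup V] [Module F V] {k : F} (hk : k ≠ 0)
    (v : V) : Submodule.span F {k • v} = Submodule.span F {v} :=
  Submodule.span_singleton_smul_eq hk.isUnit v

theorem span_eq_of_mul_eq_zero {V : Type} [AddCommGroup V] [Module F V] (R S : V)
    {p q x y : F} (hpq : p ≠ 0 ∨ q ≠ 0) (hxy : x ≠ 0 ∨ y ≠ 0)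
    (h : x * y * (q * x - p * y) = 0) :
    Submodule.span F {x • R + y • S} ∈
      ({Submodule.span F {R}, Submodule.span F {S}, Submodule.span F {p • R + q • S}} :
        Set (Submodule F V)) := by
  rcases eq_or_ne x 0 with rfl | hx
  · have hy : y ≠ 0 := by simpa using hxy
    right; left
    rw [zero_smul, zero_add, span_singleton_eq_of_smul hy]
  rcases eq_or_ne y 0 with rfl | hy
  · left
    rw [zero_smul, add_zero, span_singleton_eq_of_smul hx]
  right; right
  have h0 : q * x = p * y := by simpa [hx, hy, sub_eq_zero] using h
  have hq : q ≠ 0 := by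
    rintro rfl
    simp_all
  have hk : y / q ≠ 0 := div_ne_zero hy hq
  rw [Set.mem_singleton_iff, ← span_singleton_eq_of_smul hk (p • R + q • S), smul_add, smul_smul,
    smul_smul, div_mul_cancel₀ y hq, div_mul_eq_mul_div, mul_comm y p, ← h0,
    mul_div_cancel_left₀ x hq]

theorem ncard_span_combinations {V : Type} [AddCommGroup V] [Module F V] {R S : V}
    (hind : LinearIndependent F ![R, S]) {p q : F} (hpq : p ≠ 0 ∨ q ≠ 0) :
    let X : Set (Submodule F V) :=
      {Submodule.span F {R}, Submodule.span F {S}, Submodule.span F {p • R + q • S}}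
    (p = 0 ∨ q = 0) ∧ X.ncard = 2 ∨ (p ≠ 0 ∧ q ≠ 0) ∧ X.ncard = 3 := by
  have hRS : Submodule.span F {R} ≠ Submodule.span F {S} := by
    simpa using span_combination_ne hind (x := 1) (y := 0) (x' := 0) (y' := 1) (by simp)
  intro X
  rcases eq_or_ne p 0 with rfl | hp
  · have hq : q ≠ 0 := by simpa using hpq
    left
    simp [X, span_singleton_eq_of_smul hq, Set.ncard_pair hRS]
  rcases eq_or_ne q 0 with rfl | hq
  · left
    simp [X, span_singleton_eq_of_smul hp, Set.pair_comm _ (Submodule.span F {R}),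
      Set.ncard_pair hRS]
  right
  refine ⟨⟨hp, hq⟩, Set.ncard_eq_three.2 ⟨_, _, _, hRS, ?_, ?_, rfl⟩⟩
  · simpa using span_combination_ne hind (x := 1) (y := 0) (x' := p) (y' := q) (by simpa)
  · simpa using span_combination_ne hind (x := 0) (y := 1) (x' := p) (y' := q)
      (by simpa using hp.symm)

end

/-- A line of `PG(5,q)`, `q` even, spanned by two rank-2 points with distinct associated
conics and meeting the nucleus plane trivially, contains no rank-1 point; it has either `2`
or `3` rank-2 points, and if it has `3` then the column spaces of the three rank-2 points
are pairwise distinct planes of `F³` meeting in `{0}` (three non-concurrent lines of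
`PG(2,q)`). -/
theorem line_spanned_by_two_rank_two_points (h : ℕ) (hh : 0 < h)
    (F : Type) [Field F] [Fintype F] (hF : Fintype.card F = 2 ^ h)
    (R S : Matrix (Fin 3) (Fin 3) F) (hRsymm : R.IsSymm) (hSsymm : S.IsSymm)
    (hRrk : R.rank = 2) (hSrk : S.rank = 2)
    (hcol : colSpace F R ≠ colSpace F S)
    (L : Submodule F (Matrix (Fin 3) (Fin 3) F))
    (hL : L = Submodule.span F {R, S}) (hdim : Module.finrank F ↥L = 2)
    (hnuc : ∀ M ∈ L, M ≠ 0 → ∃ i, M i i ≠ 0) :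
    (∀ M ∈ L, M.rank ≠ 1) ∧
    (Nat.card {P | IsPointOf F L P (fun M => M.rank = 2)} = 2 ∨
      Nat.card {P | IsPointOf F L P (fun M => M.rank = 2)} = 3) ∧
    (Nat.card {P | IsPointOf F L P (fun M => M.rank = 2)} = 3 →
      ∀ M₁ M₂ M₃, M₁ ∈ L → M₂ ∈ L → M₃ ∈ L →
        M₁.rank = 2 → M₂.rank = 2 → M₃.rank = 2 →
        Submodule.span F {M₁} ≠ Submodule.span F {M₂} →
        Submodule.span F {M₁} ≠ Submodule.span F {M₃} →
        Submodule.span F {M₂} ≠ Submodule.span F {M₃} →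
        colSpace F M₁ ≠ colSpace F M₂ ∧ colSpace F M₁ ≠ colSpace F M₃ ∧
        colSpace F M₂ ≠ colSpace F M₃ ∧
        colSpace F M₁ ⊓ colSpace F M₂ ⊓ colSpace F M₃ = ⊥) := by
  have hchar : CharP F 2 := by
    obtain ⟨p, hp⟩ := CharP.exists F
    obtain ⟨n, hprime, hn⟩ := FiniteField.card F p
    have hdvd : p ∣ 2 := hprime.dvd_of_dvd_pow
      (hF ▸ hn ▸ dvd_pow_self p n.ne_zero : p ∣ 2 ^ h)
    rwa [(Nat.prime_dvd_prime_iff_eq hprime Nat.prime_two).1 hdvd] at hp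
  subst hL
  have hind : LinearIndependent F ![R, S] := by
    rw [linearIndependent_iff_card_eq_finrank_span, Fintype.card_fin, Set.finrank,
      Matrix.range_cons_cons_empty, hdim]
  have hne : ∀ x y : F, x ≠ 0 ∨ y ≠ 0 → x • R + y • S ≠ 0 := fun x y hxy h0 => by
    have := LinearIndependent.pair_iff.1 hind x y h0
    simp_all
  have hmem : ∀ M ∈ Submodule.span F {R, S}, M ≠ 0 →
      ∃ x y : F, (x ≠ 0 ∨ y ≠ 0) ∧ x • R + y • S = M := fun M hM hM0 => by
    obtain ⟨x, y, rfl⟩ := Submodule.mem_span_pair.1 hM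
    refine ⟨x, y, ?_, rfl⟩
    by_contra! hxy
    simp [hxy.1, hxy.2] at hM0
  obtain ⟨p, q, hpq, hrank, hinf⟩ := exists_pencil_determinant hRsymm hSsymm hRrk hSrk hcol
    fun x y hxy => hnuc _ (Submodule.mem_span_pair.2 ⟨x, y, rfl⟩) (hne x y hxy)
  have hspan : ∀ M ∈ Submodule.span F {R, S}, M.rank = 2 → Submodule.span F {M} ∈
      ({Submodule.span F {R}, Submodule.span F {S}, Submodule.span F {p • R + q • S}} :
        Set (Submodule F (Matrix (Fin 3) (Fin 3) F))) := fun M hM hM2 => by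
    obtain ⟨x, y, hxy, rfl⟩ := hmem M hM (by rintro rfl; simp at hM2)
    exact span_eq_of_mul_eq_zero R S hpq hxy ((hrank x y hxy).2.1 hM2)
  have hpoint : ∀ x y : F, x ≠ 0 ∨ y ≠ 0 → x * y * (q * x - p * y) = 0 →
      IsPointOf F (Submodule.span F {R, S}) (Submodule.span F {x • R + y • S})
        (fun M => M.rank = 2) := by
    intro x y hxy h0
    refine ⟨?_, finrank_span_singleton (hne x y hxy), fun M hM hM0 => ?_⟩
    · rw [Submodule.span_singleton_le_iff_mem]
      exact Submodule.mem_span_pair.2 ⟨x, y, rfl⟩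
    · obtain ⟨k, rfl⟩ := Submodule.mem_span_singleton.1 hM
      rw [Matrix.rank_smul_of_mem_nonZeroDivisors _
        (mem_nonZeroDivisors_of_ne_zero (left_ne_zero_of_smul hM0))]
      exact (hrank x y hxy).2.2 h0
  have hset : {P | IsPointOf F (Submodule.span F {R, S}) P (fun M => M.rank = 2)} =
      {Submodule.span F {R}, Submodule.span F {S}, Submodule.span F {p • R + q • S}} := by
    refine Set.Subset.antisymm ?_ ?_
    · rintro P ⟨hPL, hP1, hP2⟩
      obtain ⟨M, hMP, hM0, rfl⟩ : ∃ M ∈ P, M ≠ 0 ∧ P = Submodule.span F {M} := by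
        obtain ⟨M, hM0, hM⟩ := finrank_eq_one_iff'.1 hP1
        refine ⟨M, M.2, by simpa using hM0, le_antisymm (fun N hN => ?_) (by simp)⟩
        obtain ⟨k, hk⟩ := hM ⟨N, hN⟩
        exact Submodule.mem_span_singleton.2 ⟨k, congrArg Subtype.val hk⟩
      exact hspan M (hPL hMP) (hP2 M hMP hM0)
    · rintro P (rfl | rfl | rfl)
      · simpa using hpoint 1 0 (by simp) (by simp)
      · simpa using hpoint 0 1 (by simp) (by simp)
      · exact hpoint p q hpq (by ring)
  rw [hset, Nat.card_coe_set_eq]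
  have hcard := ncard_span_combinations hind hpq
  refine ⟨fun M hM hM1 => ?_, hcard.imp And.right And.right, fun h3 M₁ M₂ M₃ hM₁ hM₂ hM₃
    h₁ h₂ h₃ h₁₂ h₁₃ h₂₃ => ?_⟩
  · obtain ⟨x, y, hxy, rfl⟩ := hmem M hM (by rintro rfl; simp at hM1)
    have := (hrank x y hxy).1
    omega
  · obtain ⟨hp, hq⟩ : p ≠ 0 ∧ q ≠ 0 := by
      rcases hcard with hcard | hcard
      · exact absurd (hcard.2.symm.trans h3) (by norm_num)
      · exact hcard.1
    have hle : ∀ {M N : Matrix (Fin 3) (Fin 3) F}, Submodule.span F {M} = Submodule.span F {N} →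
        colSpace F M ≤ colSpace F N := fun {M N} hMN =>
      colSpace_le_of_mem_span (hMN ▸ Submodule.mem_span_singleton_self M)
    have hbot : colSpace F M₁ ⊓ colSpace F M₂ ⊓ colSpace F M₃ = ⊥ := by
      rw [eq_bot_iff, ← hinf hp hq]
      rintro z ⟨⟨z₁, z₂⟩, z₃⟩
      have e₁ := hspan M₁ hM₁ h₁
      have e₂ := hspan M₂ hM₂ h₂
      have e₃ := hspan M₃ hM₃ h₃
      rcases e₁ with e₁ | e₁ | e₁ <;> rcases e₂ with e₂ | e₂ | e₂ <;>
        first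
        | exact absurd (e₁.trans e₂.symm) h₁₂
        | rcases e₃ with e₃ | e₃ | e₃ <;>
          first
          | exact absurd (e₁.trans e₃.symm) h₁₃
          | exact absurd (e₂.trans e₃.symm) h₂₃
          | refine ⟨⟨?_, ?_⟩, ?_⟩ <;>
            first
            | exact hle e₁ z₁
            | exact hle e₂ z₂
            | exact hle e₃ z₃
    refine ⟨ne_of_inf_inf_eq_bot h₁ h₃ hbot, ?_, ?_, hbot⟩
    · exact ne_of_inf_inf_eq_bot h₁ h₂ (by rwa [inf_right_comm])
    · exact ne_of_inf_inf_eq_bot h₂ h₁ (by rwa [inf_comm, ← inf_assoc])
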